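/- arXiv:2207.07946 — 2 statements merged into one kernel-verified Lean document; each statement's English description precedes it below -/
import Mathlib

section
/- For every half-integral vector y ∈ {0, 1/2, 1}^m, the quantity ρ_A(y) := rank A^{(2)}(y) equals 4 times the maximum of |z| over all half-integral vectors z ∈ {0, 1/2, 1}^m with z ≤ y (componentwise) such that the matrix B(z) has full column rank (i.e., rank B(z) = 4|z|). -/
open Matrix

noncomputable section

/-- Wedge product `a ∧ b = a bᵀ − b aᵀ`. -/
def wedge {K : Type*} [Field K] {n : ℕ} (a b : Fin n → K) : Matrix (Fin n) (Fin n) K :=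
  vecMulVec a b - vecMulVec b a

/-- The line spanned by `a` and `b`. -/
def line {K : Type*} [Field K] {n : ℕ} (a b : Fin n → K) : Submodule K (Fin n → K) :=
  Submodule.span K {a, b}

/-- `y` is a fractional matroid matching for the lines `ℓᵢ = span {aᵢ, bᵢ}`. -/
def IsFracMatching {K : Type*} [Field K] {n m : ℕ} (a b : Fin m → Fin n → K)
    (y : Fin m → ℝ) : Prop :=
  (∀ i, 0 ≤ y i) ∧ ∀ S : Submodule K (Fin n → K),
    ∑ i, (Module.finrank K ↥(S ⊓ line (a i) (b i)) : ℝ) * y i ≤ (Module.finrank K ↥S : ℝ)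

/-- The rational function field generated over `K` by the entries of the `2 × 2`
indeterminate matrices `U₁, …, U_m`. -/
abbrev FF2 (K : Type*) [Field K] (m : ℕ) : Type _ :=
  FractionRing (MvPolynomial (Fin m × Fin 2 × Fin 2) K)

/-- The indeterminate `(Uᵢ)_{p,c}` as an element of `FF2 K m`. -/
def Uvar {K : Type*} [Field K] {m : ℕ} (i : Fin m) (p c : Fin 2) : FF2 K m :=
  algebraMap (MvPolynomial (Fin m × Fin 2 × Fin 2) K) (FF2 K m) (MvPolynomial.X (i, p, c))

def toFF2 (K : Type*) [Field K] (m : ℕ) : K →+* FF2 K m :=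
  (algebraMap (MvPolynomial (Fin m × Fin 2 × Fin 2) K) (FF2 K m)).comp MvPolynomial.C

/-- The `n × 2` matrix `Bᵢ = [aᵢ bᵢ]`. -/
def colMat {K : Type*} [Field K] {n : ℕ} (a b : Fin n → K) : Matrix (Fin n) (Fin 2) K :=
  Matrix.of fun r j => if j = 0 then a r else b r

/-- The matrix `B(z) = [U₁ ⊗ B₁ ⋯ U_m ⊗ B_m]`, where the half-integral vector `z` is
encoded by `s : Fin m → ℕ` with `sᵢ = 2 zᵢ ∈ {0, 1, 2}`, and `Uᵢ` is a `2 × sᵢ` matrix of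
distinct indeterminates.  The unused columns (those with `c ≥ sᵢ`) are padded with zeros,
so that `B(z)` has full column rank iff this matrix has rank `∑ᵢ 2 sᵢ = 4|z|`. -/
def Bmat {K : Type*} [Field K] {n m : ℕ} (a b : Fin m → Fin n → K) (s : Fin m → ℕ) :
    Matrix (Fin 2 × Fin n) (Fin m × Fin 2 × Fin 2) (FF2 K m) :=
  Matrix.of fun pr icj =>
    if (icj.2.1 : ℕ) < s icj.1 then
      Uvar icj.1 pr.1 icj.2.1 * toFF2 K m (colMat (a icj.1) (b icj.1) pr.2 icj.2.2)
    else 0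

/-- The `2 × 2` matrix `Yᵢ = Uᵢ Uᵢᵀ`, where `Uᵢ` is a `2 × sᵢ` matrix of indeterminates. -/
def Ymat {K : Type*} [Field K] {m : ℕ} (s : Fin m → ℕ) (i : Fin m) :
    Matrix (Fin 2) (Fin 2) (FF2 K m) :=
  Matrix.of fun p q => ∑ c : Fin 2, if (c : ℕ) < s i then Uvar i p c * Uvar i q c else 0

/-- The matrix `A^{(2)}(y) = ∑ᵢ (Uᵢ Uᵢᵀ) ⊗ (aᵢ ∧ bᵢ)`, where the half-integral vector `y`
is encoded by `t : Fin m → ℕ` with `tᵢ = 2 yᵢ ∈ {0, 1, 2}`. -/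
def A2 {K : Type*} [Field K] {n m : ℕ} (a b : Fin m → Fin n → K) (t : Fin m → ℕ) :
    Matrix (Fin 2 × Fin n) (Fin 2 × Fin n) (FF2 K m) :=
  ∑ i : Fin m,
    kroneckerMap (· * ·) (Ymat t i) ((wedge (a i) (b i)).map (toFF2 K m))
/-- A skew-symmetric matrix of rank `r` over a field has a nonsingular principal
`r × r` submatrix. -/
theorem exists_det_submatrix_ne_zero_of_skew {F ι : Type*} [Field F] [Fintype ι]
    {A : Matrix ι ι F} (hA : Aᵀ = -A) :
    ∃ f : Fin A.rank → ι, (A.submatrix f f).det ≠ 0 := by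
  obtain ⟨g, hg, hspan⟩ : ∃ g : Fin A.rank → ι → F, (∀ i, g i ∈ Set.range A.row) ∧
      Submodule.span F (Set.range g) = Submodule.span F (Set.range A.row) := by
    rw [A.rank_eq_finrank_span_row]
    obtain ⟨g, hg, hspan, -⟩ := Submodule.exists_fun_fin_finrank_span_eq F (Set.range A.row)
    exact ⟨g, hg, hspan⟩
  choose f hf using hg
  have hX : ∀ i, ∃ c : Fin A.rank → F, ∑ j, c j • A (f j) = A i := fun i => by
    have hi : A.row i ∈ Submodule.span F (Set.range g) :=
      hspan ▸ Submodule.subset_span ⟨i, rfl⟩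
    obtain ⟨c, hc⟩ := (Submodule.mem_span_range_iff_exists_fun F).1 hi
    exact ⟨c, by simp only [← hf] at hc; exact hc⟩
  choose X hX using hX
  have h1 : A = Matrix.of X * A.submatrix f id := by
    ext i j
    simp [← hX i, mul_apply, Finset.sum_apply]
  have h2 : A = A.submatrix id f * (Matrix.of X)ᵀ := by
    have h := congrArg transpose h1
    rw [transpose_mul, transpose_submatrix, hA] at h
    exact neg_injective (h.trans (Matrix.neg_mul (A.submatrix id f) (Matrix.of X)ᵀ))
  have h3 : A.submatrix f id = A.submatrix f f * (Matrix.of X)ᵀ :=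
    congrArg (fun M : Matrix ι ι F => M.submatrix f id) h2
  have h4 : A.rank ≤ (A.submatrix f f).rank :=
    calc A.rank = (Matrix.of X * (A.submatrix f f * (Matrix.of X)ᵀ)).rank := by rw [← h3, ← h1]
      _ ≤ _ := (rank_mul_le_right _ _).trans (rank_mul_le_left _ _)
  refine ⟨f, ?_⟩
  have h5 : LinearIndependent F (A.submatrix f f).row := by
    rw [linearIndependent_iff_card_eq_finrank_span, Set.finrank, ← rank_eq_finrank_span_row]
    exact le_antisymm (by simpa using h4) (rank_le_card_height _)
  exact ((isUnit_iff_isUnit_det _).1 (linearIndependent_rows_iff_isUnit.1 h5)).ne_zero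

/-- If a skew-symmetric matrix `N` annihilates `v` and `v` is isotropic for `W`, then the
determinant of `N + x W` is divisible by `x ^ 2` up to the square of an entry of `v`. -/
theorem sq_dvd_sq_mul_det_add_smul {S κ : Type*} [CommRing S] [Fintype κ] [DecidableEq κ]
    {N W : Matrix κ κ S} (hN : Nᵀ = -N) {v : κ → S} (hv : N *ᵥ v = 0)
    (hW : v ⬝ᵥ W *ᵥ v = 0) (x : S) (k : κ) :
    x ^ 2 ∣ v k ^ 2 * (N + x • W).det := by
  have hv' : v ᵥ* N = 0 := by
    rw [← mulVec_transpose, hN, neg_mulVec, hv, neg_zero]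
  set M := N + x • W with hM
  set w := v ᵥ* W with hw
  have hrow : v k * M.det = x * (M.updateRow k w).det := by
    rw [← smul_eq_mul, ← det_updateRow_sum, ← det_updateRow_smul]
    congr 2
    have : v ᵥ* M = x • w := by rw [hM, vecMul_add, hv', zero_add, vecMul_smul]
    rw [← this, vecMul_eq_sum]
  set M' := M.updateRow k w with hM'
  have hcol : v k * M'.det = x * (M'.updateCol k (Function.update (W *ᵥ v) k 0)).det := by
    rw [← smul_eq_mul, ← det_updateCol_sum, ← det_updateCol_smul]
    congr 2
    have hMv : M *ᵥ v = x • W *ᵥ v := by rw [hM, add_mulVec, hv, zero_add, smul_mulVec]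
    ext i
    have : ∑ j, v j • M' i j = M' i ⬝ᵥ v := by simp [dotProduct, mul_comm]
    rw [this]
    by_cases hi : i = k
    · subst hi
      simp [hM', hw, ← dotProduct_mulVec, hW]
    · have := congrFun hMv i
      simpa [hM', hi, mulVec] using this
  exact ⟨_, by rw [pow_two, mul_assoc, hrow, mul_left_comm, hcol, ← mul_assoc, ← pow_two]⟩

open Polynomial in
/-- Adding `X ^ 2` times an alternating matrix to a singular alternating matrix yields a
determinant divisible by `X ^ 4`. -/
theorem X_pow_four_dvd_det {R κ : Type*} [CommRing R] [IsDomain R] [Fintype κ] [DecidableEq κ]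
    {N W : Matrix κ κ R} (hN : Nᵀ = -N) (hdet : N.det = 0) (hW : ∀ v, v ⬝ᵥ W *ᵥ v = 0) :
    (X ^ 4 : R[X]) ∣ (N.map C + (X ^ 2 : R[X]) • W.map C).det := by
  obtain ⟨v, hv0, hv⟩ := exists_mulVec_eq_zero_iff.2 hdet
  obtain ⟨k, hk⟩ := Function.ne_iff.1 hv0
  have h := sq_dvd_sq_mul_det_add_smul (N := N.map C) (W := W.map C) (v := C ∘ v)
    (by rw [← transpose_map, hN]; ext; simp)
    (by ext1 i; rw [← RingHom.map_mulVec, hv]; simp)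
    (by rw [← map_zero (C : R →+* R[X]), ← hW v, RingHom.map_dotProduct]
        congr 1; ext1 i; exact (RingHom.map_mulVec C W v i).symm) (X ^ 2) k
  rw [← pow_mul, Function.comp_apply, ← C_pow, X_pow_dvd_iff] at h
  rw [X_pow_dvd_iff]
  intro d hd
  have hd' := h d hd
  rw [coeff_C_mul] at hd'
  exact (mul_eq_zero.1 hd').resolve_left (pow_ne_zero 2 hk)

/-- The substitution `X_v ↦ τ ^ (w v) X_v`, where `τ` is a new variable. -/
def weightScale (K : Type*) [Field K] {σ : Type*} (w : σ → ℕ) :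
    MvPolynomial σ K →+* Polynomial (MvPolynomial σ K) :=
  MvPolynomial.eval₂Hom (Polynomial.C.comp MvPolynomial.C)
    fun v => Polynomial.C (MvPolynomial.X v) * Polynomial.X ^ w v

theorem coeff_coeff_weightScale {K σ : Type*} [Field K] (w : σ → ℕ) (P : MvPolynomial σ K)
    (j : ℕ) (d : σ →₀ ℕ) :
    ((weightScale K w P).coeff j).coeff d =
      if (d.sum fun v k => k * w v) = j then P.coeff d else 0 := by
  classical
  induction P using MvPolynomial.induction_on' with
  | monomial u c =>
    have h : weightScale K w (MvPolynomial.monomial u c) =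
        Polynomial.C (MvPolynomial.monomial u c) *
          Polynomial.X ^ (u.sum fun v k => k * w v) := by
      rw [weightScale, MvPolynomial.coe_eval₂Hom, MvPolynomial.eval₂_monomial,
        MvPolynomial.monomial_eq, map_mul, mul_assoc]
      congr 1
      simp only [Finsupp.prod, Finsupp.sum, map_prod, map_pow, mul_pow,
        Finset.prod_mul_distrib, ← pow_mul, Finset.prod_pow_eq_pow_sum, mul_comm]
    rw [h, Polynomial.coeff_C_mul_X_pow, MvPolynomial.coeff_monomial]
    by_cases hud : u = d
    · subst hud
      simp only [eq_comm (a := j)]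
      split_ifs <;> simp
    · simp only [hud, if_false, ite_self]
      split_ifs <;> simp [MvPolynomial.coeff_monomial, hud]
  | add p q hp hq =>
    rw [map_add, Polynomial.coeff_add, MvPolynomial.coeff_add, hp, hq, MvPolynomial.coeff_add]
    split_ifs <;> simp

section Forms

variable {K : Type*} [Field K] {n m : ℕ}

/-- The vector `u_e ⊗ x`, where `u_e` is the column of indeterminates indexed by `e`. -/
def lineVec (e : Fin m × Fin 2) (x : Fin n → K) :
    Fin 2 × Fin n → MvPolynomial (Fin m × Fin 2 × Fin 2) K :=
  fun p => MvPolynomial.X (e.1, p.1, e.2) * MvPolynomial.C (x p.2)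

/-- The alternating matrix `(u_e u_eᵀ) ⊗ (a ∧ b)`. -/
def lineForm (a b : Fin m → Fin n → K) (e : Fin m × Fin 2) :
    Matrix (Fin 2 × Fin n) (Fin 2 × Fin n) (MvPolynomial (Fin m × Fin 2 × Fin 2) K) :=
  vecMulVec (lineVec e (a e.1)) (lineVec e (b e.1)) -
    vecMulVec (lineVec e (b e.1)) (lineVec e (a e.1))

/-- The sum of the matrices `(u_e u_eᵀ) ⊗ (a ∧ b)` over `e ∈ E`. -/
def formSum (a b : Fin m → Fin n → K) (E : Finset (Fin m × Fin 2)) :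
    Matrix (Fin 2 × Fin n) (Fin 2 × Fin n) (MvPolynomial (Fin m × Fin 2 × Fin 2) K) :=
  ∑ e ∈ E, lineForm a b e

/-- The columns of indeterminates used by the half-integral vector `s / 2`. -/
def usedColumns (s : Fin m → ℕ) : Finset (Fin m × Fin 2) :=
  Finset.univ.filter fun e => (e.2 : ℕ) < s e.1

theorem lineForm_transpose (a b : Fin m → Fin n → K) (e : Fin m × Fin 2) :
    (lineForm a b e)ᵀ = -lineForm a b e := by
  simp [lineForm, transpose_vecMulVec]

theorem formSum_transpose (a b : Fin m → Fin n → K) (E : Finset (Fin m × Fin 2)) :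
    (formSum a b E)ᵀ = -formSum a b E := by
  simp [formSum, transpose_sum, lineForm_transpose]

theorem lineForm_submatrix_alternating (a b : Fin m → Fin n → K) (e : Fin m × Fin 2)
    {r : ℕ} (f : Fin r → Fin 2 × Fin n) (v : Fin r → MvPolynomial (Fin m × Fin 2 × Fin 2) K) :
    v ⬝ᵥ (lineForm a b e).submatrix f f *ᵥ v = 0 := by
  have h : (lineForm a b e).submatrix f f =
      vecMulVec (lineVec e (a e.1) ∘ f) (lineVec e (b e.1) ∘ f) -
        vecMulVec (lineVec e (b e.1) ∘ f) (lineVec e (a e.1) ∘ f) := rfl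
  rw [h, sub_mulVec, vecMulVec_mulVec, vecMulVec_mulVec, dotProduct_sub]
  simp only [op_smul_eq_smul, dotProduct_smul, smul_eq_mul]
  rw [dotProduct_comm v, dotProduct_comm v]
  ring

theorem isHomogeneous_formSum_apply (a b : Fin m → Fin n → K) (E : Finset (Fin m × Fin 2))
    (p q : Fin 2 × Fin n) : (formSum a b E p q).IsHomogeneous 2 := by
  have hv : ∀ (e : Fin m × Fin 2) (x : Fin n → K) p, (lineVec e x p).IsHomogeneous 1 :=
    fun e x p => (MvPolynomial.isHomogeneous_X _ _).mul (MvPolynomial.isHomogeneous_C _ _)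
  rw [formSum, Matrix.sum_apply]
  exact MvPolynomial.IsHomogeneous.sum _ _ _ fun e _ =>
    ((hv _ _ _).mul (hv _ _ _)).sub ((hv _ _ _).mul (hv _ _ _))

theorem isHomogeneous_det_formSum (a b : Fin m → Fin n → K) (E : Finset (Fin m × Fin 2))
    {r : ℕ} (f : Fin r → Fin 2 × Fin n) :
    ((formSum a b E).submatrix f f).det.IsHomogeneous (2 * r) := by
  rw [det_apply]
  refine MvPolynomial.IsHomogeneous.sum _ _ _ fun σ _ => ?_
  have h := MvPolynomial.IsHomogeneous.prod Finset.univ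
    (fun i => (formSum a b E).submatrix f f (σ i) i) (fun _ => 2)
    fun i _ => isHomogeneous_formSum_apply a b E _ _
  rw [Finset.sum_const, Finset.card_univ, Fintype.card_fin, smul_eq_mul, mul_comm] at h
  rcases Int.units_eq_one_or (Equiv.Perm.sign σ) with hs | hs
  · simpa [hs] using h
  · simpa [hs] using h.neg

/-- The weight selecting the two indeterminates in the column indexed by `e`. -/
def columnWeight (e : Fin m × Fin 2) (v : Fin m × Fin 2 × Fin 2) : ℕ :=
  if (v.1, v.2.2) = e then 1 else 0

theorem weightScale_lineVec (e e' : Fin m × Fin 2) (x : Fin n → K) (p : Fin 2 × Fin n) :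
    weightScale K (columnWeight e) (lineVec e' x p) =
      Polynomial.X ^ (if e' = e then 1 else 0) * Polynomial.C (lineVec e' x p) := by
  simp only [weightScale, lineVec, map_mul, MvPolynomial.coe_eval₂Hom, MvPolynomial.eval₂_X,
    MvPolynomial.eval₂_C, columnWeight, RingHom.comp_apply]
  ring

theorem weightScale_lineForm (a b : Fin m → Fin n → K) (e e' : Fin m × Fin 2)
    (p q : Fin 2 × Fin n) :
    weightScale K (columnWeight e) (lineForm a b e' p q) =
      (Polynomial.X ^ (if e' = e then 1 else 0)) ^ 2 * Polynomial.C (lineForm a b e' p q) := by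
  simp only [lineForm, Matrix.sub_apply, vecMulVec_apply, map_sub, map_mul, weightScale_lineVec]
  ring

theorem weightScale_formSum {a b : Fin m → Fin n → K} {E : Finset (Fin m × Fin 2)}
    {e : Fin m × Fin 2} (he : e ∈ E) :
    (formSum a b E).map (weightScale K (columnWeight e)) =
      (formSum a b (E.erase e)).map Polynomial.C +
        (Polynomial.X ^ 2 : Polynomial (MvPolynomial (Fin m × Fin 2 × Fin 2) K)) •
          (lineForm a b e).map Polynomial.C := by
  ext1 p q
  have hsum : formSum a b E p q = formSum a b (E.erase e) p q + lineForm a b e p q := by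
    rw [formSum, ← Finset.sum_erase_add _ _ he]
    rfl
  rw [map_apply, hsum, map_add, weightScale_lineForm, if_pos rfl, pow_one, Matrix.add_apply,
    Matrix.smul_apply, map_apply, map_apply, smul_eq_mul, add_left_inj, formSum,
    Matrix.sum_apply, map_sum, map_sum]
  refine Finset.sum_congr rfl fun e' he' => ?_
  rw [weightScale_lineForm, if_neg (Finset.ne_of_mem_erase he'), pow_zero, one_pow, one_mul]

/-- If deleting any term of `E` makes a principal `r × r` minor of `formSum a b E` vanish, then
`E` has at most `r / 2` terms. -/
theorem two_mul_card_le_of_minimal {a b : Fin m → Fin n → K} {E : Finset (Fin m × Fin 2)}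
    {r : ℕ} {f : Fin r → Fin 2 × Fin n} (hE : ((formSum a b E).submatrix f f).det ≠ 0)
    (hmin : ∀ e ∈ E, ((formSum a b (E.erase e)).submatrix f f).det = 0) :
    2 * E.card ≤ r := by
  obtain ⟨d, hd⟩ := MvPolynomial.ne_zero_iff.1 hE
  have hdeg : ∑ v, d v = 2 * r := by
    by_contra h
    exact hd ((isHomogeneous_det_formSum a b E f).coeff_eq_zero
      (by rwa [Finsupp.degree_eq_sum]))
  have h4 : ∀ e ∈ E, 4 ≤ ∑ v, d v * columnWeight e v := fun e he => by
    have h := X_pow_four_dvd_det (N := (formSum a b (E.erase e)).submatrix f f)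
      (W := (lineForm a b e).submatrix f f)
      (by rw [transpose_submatrix, formSum_transpose]; rfl) (hmin e he)
      (lineForm_submatrix_alternating a b e f)
    have h' : ((formSum a b (E.erase e)).submatrix f f).map Polynomial.C +
        (Polynomial.X ^ 2 : Polynomial (MvPolynomial (Fin m × Fin 2 × Fin 2) K)) •
          ((lineForm a b e).submatrix f f).map Polynomial.C =
        ((formSum a b E).submatrix f f).map (weightScale K (columnWeight e)) :=
      (congrArg (fun M : Matrix (Fin 2 × Fin n) (Fin 2 × Fin n) (Polynomial
        (MvPolynomial (Fin m × Fin 2 × Fin 2) K)) => M.submatrix f f) (weightScale_formSum he)).symm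
    rw [h', ← RingHom.mapMatrix_apply, ← RingHom.map_det, Polynomial.X_pow_dvd_iff] at h
    by_contra! hlt
    have h0 := congrArg (MvPolynomial.coeff d) (h _ hlt)
    rw [coeff_coeff_weightScale, Finsupp.sum_fintype _ _ (by simp), if_pos rfl] at h0
    exact hd h0
  have hle : ∑ e ∈ E, ∑ v, d v * columnWeight e v ≤ ∑ v, d v := by
    rw [Finset.sum_comm]
    refine Finset.sum_le_sum fun v _ => ?_
    rw [← Finset.mul_sum]
    simp only [columnWeight, Finset.sum_ite_eq]
    split_ifs <;> simp
  have := Finset.sum_le_sum h4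
  rw [Finset.sum_const, smul_eq_mul] at this
  omega

theorem det_formSum_ne_zero_mono {a b : Fin m → Fin n → K} {E E' : Finset (Fin m × Fin 2)}
    (hEE' : E ⊆ E') {r : ℕ} {f : Fin r → Fin 2 × Fin n}
    (hE : ((formSum a b E).submatrix f f).det ≠ 0) :
    ((formSum a b E').submatrix f f).det ≠ 0 := by
  let φ : MvPolynomial (Fin m × Fin 2 × Fin 2) K →+* MvPolynomial (Fin m × Fin 2 × Fin 2) K :=
    MvPolynomial.eval₂Hom MvPolynomial.C
      fun v => if (v.1, v.2.2) ∈ E then MvPolynomial.X v else 0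
  have hφ : ∀ e (x : Fin n → K) p, φ (lineVec e x p) = if e ∈ E then lineVec e x p else 0 :=
    fun e x p => by simp [φ, lineVec]
  have h : φ.mapMatrix ((formSum a b E').submatrix f f) = (formSum a b E).submatrix f f := by
    ext1 i j
    simp only [RingHom.mapMatrix_apply, map_apply, submatrix_apply, formSum, Matrix.sum_apply,
      map_sum]
    rw [← Finset.sum_subset hEE']
    · refine Finset.sum_congr rfl fun e he => ?_
      simp [lineForm, vecMulVec_apply, hφ, he]
    · intro e _ he
      simp [lineForm, vecMulVec_apply, hφ, he]
  intro h0
  rw [← h, ← RingHom.map_det, h0, map_zero] at hE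
  exact hE rfl

/-- The columns of indeterminates of each line may be permuted so that those in `E` come first. -/
theorem det_formSum_usedColumns_ne_zero {a b : Fin m → Fin n → K} {E : Finset (Fin m × Fin 2)}
    {r : ℕ} {f : Fin r → Fin 2 × Fin n} (hE : ((formSum a b E).submatrix f f).det ≠ 0) :
    ((formSum a b (usedColumns fun i => (E.filter fun e => e.1 = i).card)).submatrix f f).det
      ≠ 0 := by
  have hperm : ∀ T : Finset (Fin 2), ∃ π : Equiv.Perm (Fin 2), ∀ c, c ∈ T ↔ (π c : ℕ) < T.card := by
    decide
  have hcard : ∀ i, (E.filter fun e => e.1 = i).card =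
      (Finset.univ.filter fun c => (i, c) ∈ E).card := fun i => by
    refine (Finset.card_bij (fun c _ => (i, c)) ?_ ?_ ?_).symm
    · simp
    · simp
    · rintro ⟨i', c⟩ h
      obtain ⟨h, rfl⟩ := Finset.mem_filter.1 h
      exact ⟨c, by simpa using h, rfl⟩
  choose π hπ using fun i => hperm (Finset.univ.filter fun c => (i, c) ∈ E)
  simp only [Finset.mem_filter, Finset.mem_univ, true_and] at hπ
  have hinj : Function.Injective fun v : Fin m × Fin 2 × Fin 2 => (v.1, v.2.1, π v.1 v.2.2) := by
    rintro ⟨i, p, c⟩ ⟨i', p', c'⟩ h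
    simp only [Prod.mk.injEq] at h
    obtain ⟨rfl, rfl, h⟩ := h
    rw [(π i).injective h]
  let φ := (MvPolynomial.rename (R := K)
    fun v : Fin m × Fin 2 × Fin 2 => (v.1, v.2.1, π v.1 v.2.2)).toRingHom
  have hφ : ∀ e (x : Fin n → K) p, φ (lineVec e x p) = lineVec (e.1, π e.1 e.2) x p :=
    fun e x p => by simp [φ, lineVec]
  have h : φ.mapMatrix ((formSum a b E).submatrix f f) =
      (formSum a b (usedColumns fun i => (E.filter fun e => e.1 = i).card)).submatrix f f := by
    ext1 p q
    simp only [RingHom.mapMatrix_apply, map_apply, submatrix_apply, formSum, Matrix.sum_apply,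
      map_sum]
    refine Finset.sum_bij (fun e _ => (e.1, π e.1 e.2)) ?_ ?_ ?_ ?_
    · rintro ⟨i, c⟩ he
      simpa [usedColumns, hcard, ← hπ] using he
    · rintro ⟨i, c⟩ - ⟨i', c'⟩ - h
      simp only [Prod.mk.injEq] at h
      obtain ⟨rfl, h⟩ := h
      rw [(π i).injective h]
    · rintro ⟨i, c⟩ he
      refine ⟨(i, (π i).symm c), ?_, by simp⟩
      rw [usedColumns, Finset.mem_filter, hcard] at he
      rw [hπ, Equiv.apply_symm_apply]
      exact he.2
    · intro e _
      simp [lineForm, vecMulVec_apply, hφ]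
  rw [← h, ← RingHom.map_det]
  exact (map_ne_zero_iff φ (MvPolynomial.rename_injective _ hinj)).2 hE

theorem exists_minimal_det_formSum_ne_zero {a b : Fin m → Fin n → K} {E : Finset (Fin m × Fin 2)}
    {r : ℕ} {f : Fin r → Fin 2 × Fin n} (hE : ((formSum a b E).submatrix f f).det ≠ 0) :
    ∃ E' ⊆ E, ((formSum a b E').submatrix f f).det ≠ 0 ∧
      ∀ e ∈ E', ((formSum a b (E'.erase e)).submatrix f f).det = 0 := by
  induction E using Finset.strongInduction with
  | H E ih =>
    by_cases h : ∀ e ∈ E, ((formSum a b (E.erase e)).submatrix f f).det = 0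
    · exact ⟨E, subset_rfl, hE, h⟩
    · push Not at h
      obtain ⟨e, he, hdet⟩ := h
      obtain ⟨E', hE', h'⟩ := ih _ (Finset.erase_ssubset he) hdet
      exact ⟨E', hE'.trans (Finset.erase_subset _ _), h'⟩

theorem formSum_usedColumns_map (a b : Fin m → Fin n → K) (s : Fin m → ℕ) :
    (formSum a b (usedColumns s)).map (algebraMap _ (FF2 K m)) = A2 a b s := by
  ext1 p q
  simp only [formSum, usedColumns, A2, map_apply, Matrix.sum_apply, map_sum, Finset.sum_filter,
    Fintype.sum_prod_type, kroneckerMap_apply, Ymat, of_apply, Finset.sum_mul]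
  refine Finset.sum_congr rfl fun i _ => Finset.sum_congr rfl fun c _ => ?_
  split_ifs
  · simp only [lineForm, Matrix.sub_apply, vecMulVec_apply, lineVec, wedge, toFF2, Uvar, map_sub,
      map_mul, RingHom.comp_apply]
    ring
  · simp

theorem A2_transpose (a b : Fin m → Fin n → K) (s : Fin m → ℕ) :
    (A2 a b s)ᵀ = -A2 a b s := by
  rw [← formSum_usedColumns_map, ← transpose_map, formSum_transpose]
  ext1 p q
  simp

theorem A2_submatrix_det (a b : Fin m → Fin n → K) (s : Fin m → ℕ) {r : ℕ}
    (f : Fin r → Fin 2 × Fin n) :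
    ((A2 a b s).submatrix f f).det =
      algebraMap _ (FF2 K m) ((formSum a b (usedColumns s)).submatrix f f).det := by
  rw [RingHom.map_det, ← formSum_usedColumns_map]
  rfl

theorem le_rank_A2_of_det_ne_zero {a b : Fin m → Fin n → K} {s : Fin m → ℕ} {r : ℕ}
    {f : Fin r → Fin 2 × Fin n}
    (h : ((formSum a b (usedColumns s)).submatrix f f).det ≠ 0) : r ≤ (A2 a b s).rank := by
  have h' : ((A2 a b s).submatrix f f).det ≠ 0 := by
    rw [A2_submatrix_det]
    exact (map_ne_zero_iff _ (IsFractionRing.injective _ (FF2 K m))).2 h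
  simpa [rank_of_det_ne_zero h'] using (A2 a b s).rank_submatrix_le f f

theorem exists_det_formSum_ne_zero (a b : Fin m → Fin n → K) (s : Fin m → ℕ) :
    ∃ f : Fin (A2 a b s).rank → Fin 2 × Fin n,
      ((formSum a b (usedColumns s)).submatrix f f).det ≠ 0 := by
  obtain ⟨f, hf⟩ := exists_det_submatrix_ne_zero_of_skew (A2_transpose a b s)
  refine ⟨f, fun h => hf ?_⟩
  rw [A2_submatrix_det, h, map_zero]

theorem rank_A2_mono (a b : Fin m → Fin n → K) {s t : Fin m → ℕ} (hst : ∀ i, s i ≤ t i) :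
    (A2 a b s).rank ≤ (A2 a b t).rank := by
  obtain ⟨f, hf⟩ := exists_det_formSum_ne_zero a b s
  refine le_rank_A2_of_det_ne_zero (det_formSum_ne_zero_mono ?_ hf)
  exact Finset.monotone_filter_right _ fun e _ he => he.trans_le (hst e.1)

/-- The product of `I ⊗ J` and `B(z)ᵀ`, where `J` is the standard `2 × 2` symplectic matrix. -/
def symplecticDual (a b : Fin m → Fin n → K) (s : Fin m → ℕ) :
    Matrix (Fin m × Fin 2 × Fin 2) (Fin 2 × Fin n) (FF2 K m) :=
  Matrix.of fun x q =>
    if x.2.2 = 0 then Bmat a b s q (x.1, x.2.1, 1) else -Bmat a b s q (x.1, x.2.1, 0)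

theorem Bmat_mul_symplecticDual (a b : Fin m → Fin n → K) (s : Fin m → ℕ) :
    Bmat a b s * symplecticDual a b s = A2 a b s := by
  ext1 p q
  simp only [mul_apply, symplecticDual, Bmat, A2, Matrix.sum_apply, Fintype.sum_prod_type,
    kroneckerMap_apply, Ymat, of_apply, Finset.sum_mul, map_apply]
  refine Finset.sum_congr rfl fun i _ => Finset.sum_congr rfl fun c _ => ?_
  rw [Fin.sum_univ_two]
  split_ifs
  · simp_all
  · simp [wedge, colMat, vecMulVec_apply]
    ring
  all_goals simp_all

/-- The indices of the columns of `B(z)` which are not padding. -/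
def usedEntries (s : Fin m → ℕ) : Finset (Fin m × Fin 2 × Fin 2) :=
  Finset.univ.filter fun x => (x.2.1 : ℕ) < s x.1

theorem card_usedEntries {s : Fin m → ℕ} (hs : ∀ i, s i ≤ 2) :
    (usedEntries s).card = ∑ i, 2 * s i := by
  have h : ∀ k ≤ 2, (∑ c : Fin 2, if (c : ℕ) < k then 2 else 0) = 2 * k := by decide
  rw [usedEntries, Finset.card_filter, Fintype.sum_prod_type]
  refine Finset.sum_congr rfl fun i _ => ?_
  rw [← h _ (hs i), Fintype.sum_prod_type]
  refine Finset.sum_congr rfl fun c _ => ?_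
  split_ifs <;> simp [*]

theorem Bmat_eq_zero {a b : Fin m → Fin n → K} {s : Fin m → ℕ} {x : Fin m × Fin 2 × Fin 2}
    (hx : x ∉ usedEntries s) (p : Fin 2 × Fin n) : Bmat a b s p x = 0 := by
  simp only [usedEntries, Finset.mem_filter, Finset.mem_univ, true_and] at hx
  simp [Bmat, hx]

theorem rank_Bmat_le (a b : Fin m → Fin n → K) {s : Fin m → ℕ} (hs : ∀ i, s i ≤ 2) :
    (Bmat a b s).rank ≤ ∑ i, 2 * s i := by
  rw [← card_usedEntries hs, ← rank_transpose]
  refine rank_le_card_of_support_subset _ _ fun x hx => ?_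
  by_contra h
  exact hx (funext fun p => Bmat_eq_zero (fun h' => h h') p)

/-- When `B(z)` has full column rank, it has the same rank as `A^{(2)}(z)`. -/
theorem rank_Bmat_le_rank_A2 {a b : Fin m → Fin n → K} {s : Fin m → ℕ} (hs : ∀ i, s i ≤ 2)
    (hB : (Bmat a b s).rank = ∑ i, 2 * s i) : (Bmat a b s).rank ≤ (A2 a b s).rank := by
  have hspan : Submodule.span (FF2 K m) (Set.range (Bmat a b s).col) =
      Submodule.span (FF2 K m) (Set.range fun x : usedEntries s => (Bmat a b s).col x) := by
    refine le_antisymm (Submodule.span_le.2 ?_) (Submodule.span_mono ?_)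
    · rintro _ ⟨x, rfl⟩
      by_cases hx : x ∈ usedEntries s
      · exact Submodule.subset_span ⟨⟨x, hx⟩, rfl⟩
      · have : (Bmat a b s).col x = 0 := funext (Bmat_eq_zero hx)
        rw [this]
        exact Submodule.zero_mem _
    · rintro _ ⟨x, rfl⟩
      exact ⟨x, rfl⟩
  have hLI : LinearIndependent (FF2 K m) fun x : usedEntries s => (Bmat a b s).col x := by
    rw [linearIndependent_iff_card_eq_finrank_span, Fintype.card_coe, card_usedEntries hs, ← hB,
      rank_eq_finrank_span_cols, Set.finrank, hspan]
  have hker : LinearMap.ker (A2 a b s).mulVecLin ≤ LinearMap.ker (Bmat a b s)ᵀ.mulVecLin := by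
    intro v hv
    rw [LinearMap.mem_ker, mulVecLin_apply] at hv ⊢
    rw [← Bmat_mul_symplecticDual, ← mulVec_mulVec] at hv
    set g := symplecticDual a b s *ᵥ v with hg
    have hg0 : ∀ x : usedEntries s, g x = 0 := by
      refine Fintype.linearIndependent_iff.1 hLI (fun x => g x) ?_
      rw [← hv, mulVec_eq_sum]
      simp only [op_smul_eq_smul]
      rw [Finset.sum_coe_sort (usedEntries s) fun x => g x • (Bmat a b s).col x]
      refine Finset.sum_subset (Finset.subset_univ _) fun x _ hx => ?_
      exact (congrArg (g x • ·) (funext (Bmat_eq_zero hx))).trans (smul_zero _)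
    ext ⟨i, c, j⟩
    by_cases hx : (i, c, j) ∈ usedEntries s
    · have hx' : ∀ j', (i, c, j') ∈ usedEntries s := fun j' => by
        simpa [usedEntries] using hx
      have h0 := hg0 ⟨_, hx' 0⟩
      have h1 := hg0 ⟨_, hx' 1⟩
      fin_cases j
      · simpa [hg, mulVec, dotProduct, symplecticDual] using h1
      · simpa [hg, mulVec, dotProduct, symplecticDual] using h0
    · simp [mulVec, dotProduct, Bmat_eq_zero hx]
  have h1 := (A2 a b s).mulVecLin.finrank_range_add_finrank_ker
  have h2 := (Bmat a b s)ᵀ.mulVecLin.finrank_range_add_finrank_ker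
  have h3 := Submodule.finrank_mono hker
  rw [← rank_transpose, rank, rank]
  omega

end Forms

/-- `ρ_A(y) = rank A^{(2)}(y)` equals `4` times the maximum of `|z|` over half-integral
`z ≤ y` such that `B(z)` has full column rank (here `4|z| = 2 ∑ᵢ sᵢ` with `sᵢ = 2 zᵢ`). -/
theorem rank_A2_eq_four_mul_max_fullColumnRank
    {K : Type*} [Field K] {n m : ℕ} (hn : 0 < n) (hm : 0 < m)
    (a b : Fin m → Fin n → K) (hab : ∀ i, LinearIndependent K ![a i, b i])
    (t : Fin m → ℕ) (ht : ∀ i, t i ≤ 2) :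
    (A2 a b t).rank =
      sSup {r : ℕ | ∃ s : Fin m → ℕ, (∀ i, s i ≤ t i) ∧
        (Bmat a b s).rank = ∑ i, 2 * s i ∧ r = 2 * ∑ i, s i} := by
  refine (IsGreatest.csSup_eq ⟨?_, ?_⟩).symm
  · obtain ⟨f, hf⟩ := exists_det_formSum_ne_zero a b t
    obtain ⟨E, hEt, hE, hmin⟩ := exists_minimal_det_formSum_ne_zero hf
    have hcard := two_mul_card_le_of_minimal hE hmin
    set s : Fin m → ℕ := fun i => (E.filter fun e => e.1 = i).card
    have hsum : ∑ i, s i = E.card :=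
      (Finset.card_eq_sum_card_fiberwise fun e _ => Finset.mem_univ e.1).symm
    have hst : ∀ i, s i ≤ t i := fun i => by
      have h : E.filter (fun e => e.1 = i) ⊆
          (Finset.univ.filter fun c : Fin 2 => (c : ℕ) < t i).image (Prod.mk i) := by
        rintro ⟨i', c⟩ he
        obtain ⟨hE', hi⟩ := Finset.mem_filter.1 he
        obtain rfl : i' = i := hi
        simpa [usedColumns] using hEt hE'
      have h2 : ∀ k ≤ 2, (Finset.univ.filter fun c : Fin 2 => (c : ℕ) < k).card = k := by decide
      exact (Finset.card_le_card h).trans (Finset.card_image_le.trans (h2 _ (ht i)).le)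
    have hrank : (A2 a b t).rank ≤ (A2 a b s).rank :=
      le_rank_A2_of_det_ne_zero (det_formSum_usedColumns_ne_zero hE)
    have hB : (A2 a b s).rank ≤ (Bmat a b s).rank := by
      rw [← Bmat_mul_symplecticDual]
      exact rank_mul_le_left _ _
    have hle := rank_Bmat_le a b fun i => (hst i).trans (ht i)
    rw [← Finset.mul_sum, hsum] at hle
    refine ⟨s, hst, ?_, ?_⟩
    · rw [← Finset.mul_sum, hsum]
      omega
    · rw [hsum]
      omega
  · rintro _ ⟨s, hst, hB, rfl⟩
    rw [Finset.mul_sum, ← hB]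
    exact (rank_Bmat_le_rank_A2 (fun i => (hst i).trans (ht i)) hB).trans (rank_A2_mono a b hst)
end
end

section
/- Let y ∈ {0, 1/2, 1}^m be a half-integral vector. If the matrix B(y) has full column rank (i.e., rank B(y) = 4|y|), then y is a fractional matroid matching, i.e., y ∈ P. -/
open Matrix

noncomputable section

/-- A subspace of the line through `a` and `b` has a basis whose coefficient matrix with respect
to `a, b` has a right inverse. -/
theorem exists_basis_coeff_of_le_line {K : Type*} [Field K] {n : ℕ} (a b : Fin n → K)
    (W : Submodule K (Fin n → K)) (hW : W ≤ line a b) :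
    ∃ (w : Fin (Module.finrank K W) → Fin n → K)
      (M : Matrix (Fin (Module.finrank K W)) (Fin 2) K)
      (N : Matrix (Fin 2) (Fin (Module.finrank K W)) K),
      (∀ k, w k ∈ W) ∧ (∀ k r, w k r = ∑ j, M k j * colMat a b r j) ∧ M * N = 1 := by
  let e := Module.finBasis K W
  have hmem : ∀ k, ∃ c d : K, c • a + d • b = (e k : Fin n → K) := fun k =>
    Submodule.mem_span_pair.1 (hW (e k).2)
  choose c d hcd using hmem
  let M : Matrix (Fin (Module.finrank K W)) (Fin 2) K := Matrix.of fun k => ![c k, d k]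
  have hM : ∀ k r, (e k : Fin n → K) r = ∑ j, M k j * colMat a b r j := by
    intro k r
    rw [← hcd k]
    simp [M, colMat, Fin.sum_univ_two]
  have hinj : LinearMap.ker M.vecMulLinear = ⊥ := by
    rw [LinearMap.ker_eq_bot']
    intro g hg
    have hsum : ∑ k, g k • e k = 0 := by
      ext r
      have hz : ∀ j, ∑ k, g k * M k j = 0 := fun j => congrFun hg j
      simp only [Submodule.coe_sum, Submodule.coe_smul, Finset.sum_apply, Pi.smul_apply,
        smul_eq_mul, hM, Finset.mul_sum, Submodule.coe_zero, Pi.zero_apply]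
      rw [Finset.sum_comm]
      refine Finset.sum_eq_zero fun j _ => ?_
      simp only [← mul_assoc]
      rw [← Finset.sum_mul, hz, zero_mul]
    exact funext (Fintype.linearIndependent_iff.1 e.linearIndependent g hsum)
  obtain ⟨φ, hφ⟩ := LinearMap.exists_leftInverse_of_injective _ hinj
  refine ⟨fun k => e k, M, LinearMap.toMatrixRight' φ, fun k => (e k).2, hM, ?_⟩
  apply LinearMap.toMatrixRight'.symm.injective
  change φ ∘ₗ Matrix.toLinearMapRight' M = LinearMap.id at hφ
  simpa using hφ

/-- If `B(y)` has full column rank, then its columns that are not padding are linearly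
independent. -/
theorem linearIndependent_Bmat_col {K : Type*} [Field K] {n m : ℕ} (a b : Fin m → Fin n → K)
    (t : Fin m → ℕ) (ht : ∀ i, t i ≤ 2) (hrank : (Bmat a b t).rank = ∑ i, 2 * t i) :
    LinearIndependent (FF2 K m) fun x : (i : Fin m) × Fin (t i) × Fin 2 =>
      (Bmat a b t).col (x.1, Fin.castLE (ht x.1) x.2.1, x.2.2) := by
  rw [linearIndependent_iff_card_le_finrank_span]
  have hcard : Fintype.card ((i : Fin m) × Fin (t i) × Fin 2) = ∑ i, 2 * t i := by
    simp [mul_comm]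
  rw [hcard, ← hrank, Matrix.rank_eq_finrank_span_cols]
  refine Submodule.finrank_mono (Submodule.span_le.2 ?_)
  rintro _ ⟨⟨i, c, j⟩, rfl⟩
  by_cases hc : (c : ℕ) < t i
  · exact Submodule.subset_span ⟨⟨i, ⟨c, hc⟩, j⟩, rfl⟩
  · have hzero : (Bmat a b t).col (i, c, j) = 0 := by
      ext pr
      simp [Bmat, Matrix.col, hc]
    rw [hzero]
    exact Submodule.zero_mem _

/-- The integral form of the fractional matching inequalities. -/
theorem sum_finrank_inf_line_mul_le {K : Type*} [Field K] {n m : ℕ} (a b : Fin m → Fin n → K)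
    (t : Fin m → ℕ) (ht : ∀ i, t i ≤ 2) (hrank : (Bmat a b t).rank = ∑ i, 2 * t i)
    (S : Submodule K (Fin n → K)) :
    ∑ i, t i * Module.finrank K ↥(S ⊓ line (a i) (b i)) ≤ 2 * Module.finrank K S := by
  choose w M N hw hM hMN using fun i =>
    exists_basis_coeff_of_le_line (a i) (b i) (S ⊓ line (a i) (b i)) inf_le_right
  let e := Module.finBasis K S
  let C : ((i : Fin m) × Fin (t i) × Fin (Module.finrank K ↥(S ⊓ line (a i) (b i)))) →
      Fin 2 × Fin (Module.finrank K S) → FF2 K m := fun x pl =>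
    Uvar x.1 pl.1 (Fin.castLE (ht x.1) x.2.1) *
      toFF2 K m (e.repr ⟨w x.1 x.2.2, (hw x.1 x.2.2).1⟩ pl.2)
  have hcoord : ∀ i k r, w i k r =
      ∑ l, e.repr ⟨w i k, (hw i k).1⟩ l * (e l : Fin n → K) r := by
    intro i k r
    have h := congrArg (fun v : S => (v : Fin n → K) r) (e.sum_repr ⟨w i k, (hw i k).1⟩)
    simp only [Submodule.coe_sum, Submodule.coe_smul, Finset.sum_apply, Pi.smul_apply,
      smul_eq_mul] at h
    exact h.symm
  have hC : LinearIndependent (FF2 K m) C := by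
    rw [Fintype.linearIndependent_iff]
    intro g hg
    have hB := Fintype.linearIndependent_iff.1 (linearIndependent_Bmat_col a b t ht hrank)
      (fun x => ∑ k, g ⟨x.1, x.2.1, k⟩ * toFF2 K m (M x.1 k x.2.2)) (by
        ext ⟨p, r⟩
        have hl : ∀ l, ∑ x, g x * C x (p, l) = 0 := fun l => by
          simpa using congrFun hg (p, l)
        have hx : ∑ x, g x * (Uvar x.1 p (Fin.castLE (ht x.1) x.2.1) *
            toFF2 K m (w x.1 x.2.2 r)) = 0 := by
          have hsum : ∑ l, (∑ x, g x * C x (p, l)) * toFF2 K m ((e l : Fin n → K) r) = 0 := by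
            simp [hl]
          rw [← hsum]
          simp only [Finset.sum_mul]
          rw [Finset.sum_comm]
          refine Finset.sum_congr rfl fun x _ => ?_
          rw [hcoord, map_sum, Finset.mul_sum, Finset.mul_sum]
          refine Finset.sum_congr rfl fun l _ => ?_
          simp only [C, map_mul]
          ring
        rw [Pi.zero_apply, ← hx]
        simp only [Finset.sum_apply, Pi.smul_apply, smul_eq_mul, Matrix.col_apply]
        simp only [Fintype.sum_sigma, Fintype.sum_prod_type]
        refine Finset.sum_congr rfl fun i _ => Finset.sum_congr rfl fun c _ => ?_
        simp only [hM, map_sum, Finset.mul_sum, Finset.sum_mul]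
        rw [Finset.sum_comm]
        refine Finset.sum_congr rfl fun k _ => Finset.sum_congr rfl fun j _ => ?_
        simp only [Bmat, Matrix.of_apply, Fin.val_castLE, c.2, if_true, map_mul]
        ring)
    rintro ⟨i, c, k⟩
    have hN : ∀ k', ∑ j, toFF2 K m (M i k' j) * toFF2 K m (N i j k) =
        if k' = k then 1 else 0 := by
      intro k'
      have h := congrFun (congrFun (hMN i) k') k
      rw [Matrix.mul_apply, Matrix.one_apply] at h
      simp only [← map_mul, ← map_sum, h]
      split_ifs <;> simp
    have hg' : ∑ j, (∑ k', g ⟨i, c, k'⟩ * toFF2 K m (M i k' j)) * toFF2 K m (N i j k) = 0 :=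
      Finset.sum_eq_zero fun j _ => by rw [hB ⟨i, c, j⟩, zero_mul]
    simp only [Finset.sum_mul] at hg'
    rw [Finset.sum_comm] at hg'
    simpa only [mul_assoc, ← Finset.mul_sum, hN, mul_ite, mul_one, mul_zero,
      Finset.sum_ite_eq', Finset.mem_univ, if_true] using hg'
  simpa using hC.fintype_card_le_finrank

/-- If `B(y)` has full column rank, then the half-integral vector `y` (encoded by
`t : Fin m → ℕ`, `yᵢ = tᵢ / 2`) is a fractional matroid matching. -/
theorem fracMatching_of_fullColumnRank
    {K : Type*} [Field K] {n m : ℕ} (hn : 0 < n) (hm : 0 < m)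
    (a b : Fin m → Fin n → K) (hab : ∀ i, LinearIndependent K ![a i, b i])
    (t : Fin m → ℕ) (ht : ∀ i, t i ≤ 2)
    (hrank : (Bmat a b t).rank = ∑ i, 2 * t i) :
    IsFracMatching a b (fun i => (t i : ℝ) / 2) := by
  refine ⟨fun i => by positivity, fun S => ?_⟩
  have h : ((∑ i, t i * Module.finrank K ↥(S ⊓ line (a i) (b i)) : ℕ) : ℝ) ≤
      ((2 * Module.finrank K S : ℕ) : ℝ) :=
    Nat.cast_le.2 (sum_finrank_inf_line_mul_le a b t ht hrank S)
  push_cast at h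
  have heq : ∑ i, (Module.finrank K ↥(S ⊓ line (a i) (b i)) : ℝ) * ((t i : ℝ) / 2) =
      (∑ i, (t i : ℝ) * (Module.finrank K ↥(S ⊓ line (a i) (b i)) : ℝ)) / 2 := by
    rw [Finset.sum_div]
    exact Finset.sum_congr rfl fun i _ => by ring
  rw [heq]
  linarith
end
end
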